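/- arXiv:1602.08879 — 4 statements merged into one kernel-verified Lean document; each statement's English description precedes it below -/
import Mathlib

section
/- There is no Skolem sequence of order m when m ≡ 2 or 3 (mod 4). -/
/-- A Skolem sequence of order `m`. -/
def IsSkolemSeq (m : ℕ) (a b : Fin m → ℕ) : Prop :=
  Function.Injective (Sum.elim a b) ∧
  (∀ i : Fin m, a i + ((i : ℕ) + 1) = b i) ∧
  (∀ x : ℕ, (∃ s : Fin m ⊕ Fin m, Sum.elim a b s = x) ↔ x ∈ Finset.Icc 1 (2 * m))

theorem no_skolemSeq_of_mod_four (m : ℕ) (h : m % 4 = 2 ∨ m % 4 = 3) :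
    ¬ ∃ a b : Fin m → ℕ, IsSkolemSeq m a b := by
  rintro ⟨a, b, hinj, hd, hx⟩
  have himg : (Finset.univ : Finset (Fin m ⊕ Fin m)).image (Sum.elim a b)
      = Finset.Icc 1 (2 * m) := by
    ext x
    rw [← hx x]
    simp only [Finset.mem_image, Finset.mem_univ, true_and]
  have h1 : ∑ s : Fin m ⊕ Fin m, Sum.elim a b s = ∑ x ∈ Finset.Icc 1 (2 * m), x := by
    rw [← himg, Finset.sum_image (fun x _ y _ hxy => hinj hxy)]
  have gauss : ∀ n : ℕ, 2 * ∑ x ∈ Finset.Icc 1 n, x = n * (n + 1) := by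
    intro n
    induction n with
    | zero => simp
    | succ k ih =>
      rw [Finset.sum_Icc_succ_top (by omega), mul_add, ih]
      ring
  have gauss2 : ∀ n : ℕ, 2 * ∑ i : Fin n, ((i : ℕ) + 1) = n * (n + 1) := by
    intro n
    induction n with
    | zero => simp
    | succ k ih =>
      rw [Fin.sum_univ_castSucc, mul_add]
      simp only [Fin.val_castSucc, Fin.val_last]
      rw [ih]
      ring
  have h2 : ∑ i, b i = ∑ i, a i + ∑ i : Fin m, ((i : ℕ) + 1) := by
    rw [← Finset.sum_add_distrib]
    exact Finset.sum_congr rfl (fun i _ => (hd i).symm)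
  rw [Fintype.sum_sum_type] at h1
  simp only [Sum.elim_inl, Sum.elim_inr] at h1
  have g1 := gauss (2 * m)
  have g2 := gauss2 m
  rw [← h1, h2] at g1
  generalize ∑ i : Fin m, ((i : ℕ) + 1) = T at *
  generalize ∑ i, a i = A at *
  have key : 4 * A + m * (m + 1) = 2 * m * (2 * m + 1) := by
    rw [← g1, ← g2]
    ring
  obtain ⟨k, hk⟩ : ∃ k, m = 4 * k + 2 ∨ m = 4 * k + 3 := ⟨m / 4, by omega⟩
  clear * - key hk
  rcases hk with rfl | rfl <;> ring_nf at key <;> omega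
end

section
/- A Langford sequence of order m and defect d exists if and only if m ≥ 2d − 1, and additionally m ≡ 0 or 1 (mod 4) if d is odd, while m ≡ 0 or 3 (mod 4) if d is even. -/
/-- A Langford sequence of order `m` and defect `d`: pairs `(a i, b i)` for the
symbols `d + i` (`i : Fin m`), with `b i - a i = d + i`, whose entries partition
`{1,…,2m}`. -/
def IsLangfordSeq (m d : ℕ) (a b : Fin m → ℕ) : Prop :=
  Function.Injective (Sum.elim a b) ∧
  (∀ i : Fin m, a i + (d + (i : ℕ)) = b i) ∧
  (∀ x : ℕ, (∃ s : Fin m ⊕ Fin m, Sum.elim a b s = x) ↔ x ∈ Finset.Icc 1 (2 * m))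

/-! ### Sufficiency: from a symbol table covering all positions to a Langford sequence -/

/-- If each position of `{1,…,2m}` carries some symbol, counting forces a partition. -/
lemma exists_of_cover (m d : ℕ) (A : ℕ → ℕ)
    (h : ∀ p, 1 ≤ p → p ≤ 2 * m → ∃ k, d ≤ k ∧ k < d + m ∧ (p = A k ∨ p = A k + k)) :
    ∃ a b : Fin m → ℕ, IsLangfordSeq m d a b := by
  classical
  refine ⟨fun i => A (d + i), fun i => A (d + i) + (d + i), ?_⟩
  set g : Fin m ⊕ Fin m → ℕ :=
    Sum.elim (fun i => A (d + i)) (fun i => A (d + i) + (d + i)) with hg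
  have hsub : Finset.Icc 1 (2 * m) ⊆ Finset.univ.image g := by
    intro p hp
    rw [Finset.mem_Icc] at hp
    obtain ⟨k, hk1, hk2, hk⟩ := h p hp.1 hp.2
    obtain ⟨j, rfl⟩ := Nat.exists_eq_add_of_le hk1
    rw [Finset.mem_image]
    rcases hk with hk | hk
    · exact ⟨Sum.inl ⟨j, by omega⟩, Finset.mem_univ _, by simp [hg, hk]⟩
    · exact ⟨Sum.inr ⟨j, by omega⟩, Finset.mem_univ _, by simp [hg, hk]⟩
  have hcu : (Finset.univ : Finset (Fin m ⊕ Fin m)).card = 2 * m := by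
    simp [two_mul]
  have hle : (Finset.univ.image g).card ≤ 2 * m := hcu ▸ Finset.card_image_le
  have heq := Finset.eq_of_subset_of_card_le hsub (by simpa using hle)
  refine ⟨?_, fun i => rfl, fun x => ?_⟩
  · have : (Finset.univ.image g).card = (Finset.univ : Finset (Fin m ⊕ Fin m)).card := by
      rw [← heq, hcu]; simp
    have := Finset.card_image_iff.mp this
    intro x y hxy
    exact this (by simp) (by simp) hxy
  · rw [heq]; simp [hg]

lemma ite_spec {P : Prop} [Decidable P] {k x y : ℕ} (h : k = if P then x else y) :
    (P ∧ k = x) ∨ (¬P ∧ k = y) := by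
  by_cases c : P
  · exact Or.inl ⟨c, by rw [h, if_pos c]⟩
  · exact Or.inr ⟨c, by rw [h, if_neg c]⟩

lemma chain_spec {lo T p k x y : ℕ} (hlo : lo ≤ p) (h : k = if p < T then x else y) :
    (lo ≤ p ∧ p < T ∧ k = x) ∨ (T ≤ p ∧ k = y) := by
  rcases ite_spec h with ⟨c, h⟩ | ⟨c, h⟩ <;> omega

lemma sub_spec {k x y : ℕ} (h : k = x - y) (hxy : y ≤ x) : k + y = x := by omega

def sumP (s f e k : ℕ) : ℕ :=
  if k = 4 * s + 4 * f + 2 * e + 4 then 8 * s + 6 * f + 4 * e + 6 else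
  if k % 2 = e then
    if k < 2 * s + 2 * f + e + 2 then 14 * s + 12 * f + 7 * e + 12 else
    if k < 2 * s + 2 * f + e + 4 then 8 * s + 6 * f + 5 * e + 6 else
    if k < 4 * s + 4 * f + 3 * e + 4 then 6 * s + 4 * f + 3 * e + 4 else
    10 * s + 8 * f + 5 * e + 8
  else
    if k < 2 * s + 2 * f + e + 3 then 6 * s + 4 * f + 3 * e + 5 else
    if k < 2 * s + 4 * f + e + 3 then 14 * s + 12 * f + 7 * e + 11 else
    if k < 4 * s + 4 * f + e + 5 then 10 * s + 8 * f + 5 * e + 9 else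
    6 * s + 4 * f + 3 * e + 5

def symP (s f e p : ℕ) : ℕ :=
  if p < s + 1 then 6 * s + 4 * f + 3 * e + 5 - 2 * p else
  if p < 2 * s + f + e + 1 then 6 * s + 4 * f + 3 * e + 4 - 2 * p else
  if p < 2 * s + f + e + 2 then 8 * s + 6 * f + 4 * e + 6 - 2 * p else
  if p < 2 * s + 2 * f + e + 2 then 6 * s + 4 * f + 3 * e + 5 - 2 * p else
  if p < 3 * s + 2 * f + 2 * e + 2 then 10 * s + 8 * f + 5 * e + 8 - 2 * p else
  if p < 3 * s + 2 * f + 2 * e + 3 then 8 * s + 6 * f + 5 * e + 6 - 2 * p else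
  if p < 4 * s + 2 * f + 2 * e + 4 then 10 * s + 8 * f + 5 * e + 9 - 2 * p else
  if p < 4 * s + 3 * f + 2 * e + 4 then 2 * p - (6 * s + 4 * f + 3 * e + 5) else
  if p < 5 * s + 4 * f + 3 * e + 4 then 2 * p - (6 * s + 4 * f + 3 * e + 4) else
  if p < 5 * s + 4 * f + 3 * e + 5 then 2 * p - (8 * s + 6 * f + 5 * e + 6) else
  if p < 6 * s + 4 * f + 3 * e + 5 then 2 * p - (6 * s + 4 * f + 3 * e + 5) else
  if p < 6 * s + 5 * f + 3 * e + 5 then 14 * s + 12 * f + 7 * e + 11 - 2 * p else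
  if p < 6 * s + 5 * f + 3 * e + 6 then 2 * p - (8 * s + 6 * f + 4 * e + 6) else
  if p < 6 * s + 6 * f + 3 * e + 6 then 14 * s + 12 * f + 7 * e + 12 - 2 * p else
  if p < 7 * s + 6 * f + 3 * e + 7 then 2 * p - (10 * s + 8 * f + 5 * e + 9) else
  if p < 8 * s + 6 * f + 4 * e + 7 then 2 * p - (10 * s + 8 * f + 5 * e + 8) else
  if p < 8 * s + 7 * f + 4 * e + 7 then 2 * p - (14 * s + 12 * f + 7 * e + 12) else
  2 * p - (14 * s + 12 * f + 7 * e + 11)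

set_option maxHeartbeats 4000000 in
lemma surjP (s f e p : ℕ) (he : e ≤ 1) (h1 : 1 ≤ p) (h2 : p ≤ 2 * (4 * s + 4 * f + 2 * e + 3)) :
    ∃ k, 2 * s + e + 2 ≤ k ∧ k < 2 * s + e + 2 + (4 * s + 4 * f + 2 * e + 3) ∧
      (p = (sumP s f e k - k) / 2 ∨ p = (sumP s f e k - k) / 2 + k) := by
  obtain ⟨k, hk⟩ : ∃ k, k = symP s f e p := ⟨_, rfl⟩
  obtain ⟨t, ht⟩ : ∃ t, t = sumP s f e k := ⟨_, rfl⟩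
  suffices h : (2 * s + e + 2 ≤ k ∧ k < 2 * s + e + 2 + (4 * s + 4 * f + 2 * e + 3)) ∧
      (2 * p + k = t ∨ 2 * p = t + k ∧ k ≤ p) by
    refine ⟨k, h.1.1, h.1.2, ?_⟩
    rw [← ht]
    omega
  unfold sumP at ht
  unfold symP at hk
  obtain rfl | rfl : e = 0 ∨ e = 1 := by omega
  all_goals
    clear he
    simp only [Nat.reduceMul, Nat.sub_zero, Nat.add_zero, Nat.add_one_sub_one] at hk ht h2 ⊢
    repeat' (have h := chain_spec h1 hk; clear h1 hk; obtain ⟨h1, c, hk⟩ | ⟨h1, hk⟩ := h)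
    all_goals
      replace hk := sub_spec hk (by omega)
      have h3 : 2 * s + 2 ≤ k := by omega
      refine ⟨by omega, ?_⟩
      obtain ⟨hq, ht⟩ | ⟨hq, ht0⟩ := ite_spec ht
      · omega
      clear ht
      obtain ⟨hp, ht⟩ | ⟨hp, ht⟩ := ite_spec ht0
      all_goals
        clear ht0
        repeat' (have h := chain_spec h3 ht; clear h3 ht; obtain ⟨h3, c', ht⟩ | ⟨h3, ht⟩ := h)
        all_goals omega

def sumQ (s f e k : ℕ) : ℕ :=
  if k = 4 * s + 4 * f + 4 then 8 * s + 6 * f + 2 * e + 8 else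
  if k % 2 = 1 - e then
    if k < 2 * s + 2 * f + 3 - e then 14 * s + 12 * f + e + 15 else
    if k < 2 * s + 2 * f + 5 - e then 4 * s + 2 * f + e + 5 else
    if k < 4 * s + 4 * f + 5 - e then 6 * s + 4 * f + e + 7 else
    10 * s + 8 * f + e + 11
  else
    if k < 2 * s + 2 * f + 4 - e then 6 * s + 4 * f + e + 8 else
    if k < 2 * s + 4 * f + 4 - e then 14 * s + 12 * f + e + 14 else
    if k < 4 * s + 4 * f + e + 4 then 10 * s + 8 * f + e + 12 else
    6 * s + 4 * f + e + 6

def symQ (s f e p : ℕ) : ℕ :=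
  if p < s + e + 1 then 6 * s + 4 * f + e + 6 - 2 * p else
  if p < s + e + 2 then 4 * s + 2 * f + e + 5 - 2 * p else
  if p < 2 * s + f + e + 2 then 6 * s + 4 * f + e + 7 - 2 * p else
  if p < 2 * s + f + e + 3 then 8 * s + 6 * f + 2 * e + 8 - 2 * p else
  if p < 2 * s + 2 * f + 4 then 6 * s + 4 * f + e + 8 - 2 * p else
  if p < 3 * s + 2 * f + 4 then 10 * s + 8 * f + e + 11 - 2 * p else
  if p < 3 * s + 2 * f + 5 then 2 * p - (4 * s + 2 * f + e + 5) else
  if p < 4 * s + 2 * f + e + 5 then 10 * s + 8 * f + e + 12 - 2 * p else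
  if p < 4 * s + 3 * f + 6 then 2 * p - (6 * s + 4 * f + e + 8) else
  if p < 5 * s + 4 * f + 6 then 2 * p - (6 * s + 4 * f + e + 7) else
  if p < 6 * s + 4 * f + e + 6 then 2 * p - (6 * s + 4 * f + e + 6) else
  if p < 6 * s + 5 * f + e + 6 then 14 * s + 12 * f + e + 14 - 2 * p else
  if p < 6 * s + 5 * f + e + 7 then 2 * p - (8 * s + 6 * f + 2 * e + 8) else
  if p < 6 * s + 6 * f + 8 then 14 * s + 12 * f + e + 15 - 2 * p else
  if p < 7 * s + 6 * f + e + 8 then 2 * p - (10 * s + 8 * f + e + 12) else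
  if p < 8 * s + 6 * f + e + 8 then 2 * p - (10 * s + 8 * f + e + 11) else
  if p < 8 * s + 7 * f + 9 then 2 * p - (14 * s + 12 * f + e + 15) else
  2 * p - (14 * s + 12 * f + e + 14)

set_option maxHeartbeats 4000000 in
lemma surjQ (s f e p : ℕ) (he : e ≤ 1) (h1 : 1 ≤ p) (h2 : p ≤ 2 * (4 * s + 4 * f + 4)) :
    ∃ k, 2 * s + e + 1 ≤ k ∧ k < 2 * s + e + 1 + (4 * s + 4 * f + 4) ∧
      (p = (sumQ s f e k - k) / 2 ∨ p = (sumQ s f e k - k) / 2 + k) := by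
  obtain ⟨k, hk⟩ : ∃ k, k = symQ s f e p := ⟨_, rfl⟩
  obtain ⟨t, ht⟩ : ∃ t, t = sumQ s f e k := ⟨_, rfl⟩
  suffices h : (2 * s + e + 1 ≤ k ∧ k < 2 * s + e + 1 + (4 * s + 4 * f + 4)) ∧
      (2 * p + k = t ∨ 2 * p = t + k ∧ k ≤ p) by
    refine ⟨k, h.1.1, h.1.2, ?_⟩
    rw [← ht]
    omega
  unfold sumQ at ht
  unfold symQ at hk
  obtain rfl | rfl : e = 0 ∨ e = 1 := by omega
  all_goals
    clear he
    simp only [Nat.reduceMul, Nat.sub_zero, Nat.add_zero, Nat.add_one_sub_one] at hk ht h2 ⊢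
    repeat' (have h := chain_spec h1 hk; clear h1 hk; obtain ⟨h1, c, hk⟩ | ⟨h1, hk⟩ := h)
    all_goals
      replace hk := sub_spec hk (by omega)
      have h3 : 2 * s + 1 ≤ k := by omega
      refine ⟨by omega, ?_⟩
      obtain ⟨hq, ht⟩ | ⟨hq, ht0⟩ := ite_spec ht
      · omega
      clear ht
      obtain ⟨hp, ht⟩ | ⟨hp, ht⟩ := ite_spec ht0
      all_goals
        clear ht0
        repeat' (have h := chain_spec h3 ht; clear h3 ht; obtain ⟨h3, c', ht⟩ | ⟨h3, ht⟩ := h)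
        all_goals omega

lemma exists_langford (m d : ℕ) (hm : 1 ≤ m) (hd : 1 ≤ d) (h : 2 * d - 1 ≤ m)
    (ho : Odd d → m % 4 = 0 ∨ m % 4 = 1) (he : Even d → m % 4 = 0 ∨ m % 4 = 3) :
    ∃ a b : Fin m → ℕ, IsLangfordSeq m d a b := by
  rw [Nat.odd_iff] at ho
  rw [Nat.even_iff] at he
  by_cases h0 : m % 4 = 0
  · obtain ⟨s, f, e, he1, rfl, rfl⟩ : ∃ s f e : ℕ, e ≤ 1 ∧ d = 2 * s + e + 1 ∧
        m = 4 * s + 4 * f + 4 :=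
      ⟨(d - 1) / 2, (m - 4 * ((d - 1) / 2) - 4) / 4, (d - 1) % 2, by omega, by omega, by omega⟩
    exact exists_of_cover _ _ (fun k => (sumQ s f e k - k) / 2)
      fun p h1 h2 => surjQ s f e p he1 h1 h2
  by_cases hd1 : d = 1
  · subst hd1
    by_cases hm1 : m = 1
    · subst hm1
      exact exists_of_cover 1 1 (fun _ => 1) fun p h1 h2 => ⟨1, by omega, by omega, by omega⟩
    obtain ⟨f, rfl⟩ : ∃ f, m = 4 * f + 5 := ⟨(m - 5) / 4, by omega⟩
    refine exists_of_cover _ _ (fun k => if k = 1 then 1 else (sumQ 0 f 1 k - k) / 2 + 2)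
      fun p h1 h2 => ?_
    by_cases hp : p ≤ 2
    · exact ⟨1, by omega, by omega, by simp; omega⟩
    obtain ⟨k, hk1, hk2, hk⟩ := surjQ 0 f 1 (p - 2) le_rfl (by omega) (by omega)
    refine ⟨k, by omega, by omega, ?_⟩
    rw [if_neg (by omega)]
    omega
  · obtain ⟨s, f, e, he1, rfl, rfl⟩ : ∃ s f e : ℕ, e ≤ 1 ∧ d = 2 * s + e + 2 ∧
        m = 4 * s + 4 * f + 2 * e + 3 :=
      ⟨d / 2 - 1, (m + 1 - 2 * d) / 4, d % 2, by omega, by omega, by omega⟩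
    exact exists_of_cover _ _ (fun k => (sumP s f e k - k) / 2)
      fun p h1 h2 => surjP s f e p he1 h1 h2

/-! ### Necessity: double counting -/

/-- A finite set of `n` positive integers has sum at least `1 + ⋯ + n`. -/
lemma sum_lower (S : Finset ℕ) : (∀ x ∈ S, 1 ≤ x) → S.card * (S.card + 1) ≤ 2 * ∑ x ∈ S, x := by
  induction S using Finset.induction_on_max with
  | empty => simp
  | insert a S hlt ih =>
    intro hpos
    have ha : a ∉ S := fun h => lt_irrefl _ (hlt a h)
    have ih' := ih fun x hx => hpos x (Finset.mem_insert_of_mem hx)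
    have hsub : S ⊆ Finset.Ico 1 a := fun x hx =>
      Finset.mem_Ico.mpr ⟨hpos x (Finset.mem_insert_of_mem hx), hlt x hx⟩
    have hc := Finset.card_le_card hsub
    have ha1 := hpos a (Finset.mem_insert_self _ _)
    rw [Nat.card_Ico] at hc
    rw [Finset.sum_insert ha, Finset.card_insert_of_notMem ha]
    have : S.card + 1 ≤ a := by omega
    nlinarith

lemma necessary (m d : ℕ) (hm : 1 ≤ m) (a b : Fin m → ℕ) (h : IsLangfordSeq m d a b) :
    2 * d - 1 ≤ m ∧ (Odd d → m % 4 = 0 ∨ m % 4 = 1) ∧ (Even d → m % 4 = 0 ∨ m % 4 = 3) := by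
  classical
  obtain ⟨hinj, hab, hcov⟩ := h
  have himg : Finset.univ.image (Sum.elim a b) = Finset.Icc 1 (2 * m) := by
    ext x; rw [← hcov x]; simp
  have hgauss : ∀ n : ℕ, 2 * ∑ x ∈ Finset.Icc 1 n, x = n * (n + 1) := by
    intro n
    induction n with
    | zero => simp
    | succ n ih => rw [Finset.sum_Icc_succ_top (by omega), mul_add, ih]; ring
  have htot : ∑ i, a i + ∑ i, b i = ∑ x ∈ Finset.Icc 1 (2 * m), x := by
    rw [← himg, Finset.sum_image fun x _ y _ hxy => hinj hxy, Fintype.sum_sum_type]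
    rfl
  have hdiff : ∑ i, b i = ∑ i, a i + (m * d + ∑ i ∈ Finset.range m, i) := by
    rw [← Fin.sum_univ_eq_sum_range (fun i => i) m]
    simp_rw [← hab]
    simp [Finset.sum_add_distrib]
  have hr := Finset.sum_range_id_mul_two m
  have hg := hgauss (2 * m)
  have hainj : Function.Injective a := fun x y hxy => by
    have := @hinj (Sum.inl x) (Sum.inl y) hxy
    simpa using this
  have hlow := sum_lower (Finset.univ.image a) (by
    intro x hx
    obtain ⟨i, -, rfl⟩ := Finset.mem_image.mp hx
    exact (Finset.mem_Icc.mp ((hcov (a i)).mp ⟨Sum.inl i, rfl⟩)).1)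
  rw [Finset.card_image_of_injective _ hainj, Finset.sum_image fun x _ y _ hxy => hainj hxy,
    Finset.card_univ, Fintype.card_fin] at hlow
  obtain ⟨n, rfl⟩ : ∃ n, m = n + 1 := ⟨m - 1, by omega⟩
  rw [Nat.add_sub_cancel] at hr
  generalize ∑ i, a i = T at *
  generalize ∑ i, b i = U at *
  generalize ∑ i ∈ Finset.range (n + 1), i = V at *
  generalize ∑ x ∈ Finset.Icc 1 (2 * (n + 1)), x = W at *
  have key : 4 * T + 2 * d * (n + 1) = (n + 1) * (3 * n + 6) := by nlinarith
  refine ⟨?_, ?_, ?_⟩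
  · have : (n + 1) * (2 * d) ≤ (n + 1) * (n + 2) := by nlinarith
    have := Nat.le_of_mul_le_mul_left this (by omega)
    omega
  · rintro ⟨s, rfl⟩
    obtain ⟨q, r, hr4, rfl⟩ : ∃ q r, r < 4 ∧ n = 4 * q + r := ⟨n / 4, n % 4, by omega, by omega⟩
    interval_cases r <;> ring_nf at key <;> omega
  · rintro ⟨s, rfl⟩
    obtain ⟨q, r, hr4, rfl⟩ : ∃ q r, r < 4 ∧ n = 4 * q + r := ⟨n / 4, n % 4, by omega, by omega⟩
    interval_cases r <;> ring_nf at key <;> omega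

theorem langfordSeq_exists_iff (m d : ℕ) (hm : 1 ≤ m) (hd : 1 ≤ d) :
    (∃ a b : Fin m → ℕ, IsLangfordSeq m d a b) ↔
      (2 * d - 1 ≤ m ∧ (Odd d → m % 4 = 0 ∨ m % 4 = 1) ∧
        (Even d → m % 4 = 0 ∨ m % 4 = 3)) := by
  constructor
  · rintro ⟨a, b, h⟩
    exact necessary m d hm a b h
  · rintro ⟨h, ho, he⟩
    exact exists_langford m d hm hd h ho he
end

section
/- The number of Skolem circles of order m in standard positional labeling is at most 2(m−2)(2m−2)^{m−5} for m ≥ 5; consequently the count of Skolem circles is O(m^m). -/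
/-- A Skolem circle of order `m`: pairs `(a i, b i)` of positions in `ZMod (2m)`
for the symbols `i+1` (`i : Fin m`), all `2m` entries distinct, with
`b i - a i ≡ i+1 (mod 2m)`. -/
def IsSkolemCircle (m : ℕ) (a b : Fin m → ZMod (2 * m)) : Prop :=
  Function.Injective (Sum.elim a b) ∧
  (∀ i : Fin m, b i - a i = (((i : ℕ) + 1 : ℕ) : ZMod (2 * m)))

/-- Circle equivalence: `C₂` is obtained from `C₁` by a rotation `+x`, or by
the reflection `v ↦ x - v` (which swaps the two entries of each pair). -/
def CircleEquiv (m : ℕ)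
    (C₁ C₂ : (Fin m → ZMod (2 * m)) × (Fin m → ZMod (2 * m))) : Prop :=
  ∃ x : ZMod (2 * m),
    (∀ i, C₂.1 i = C₁.1 i + x ∧ C₂.2 i = C₁.2 i + x) ∨
    (∀ i, C₂.1 i = x - C₁.2 i ∧ C₂.2 i = x - C₁.1 i)

theorem skListSum (g : ℕ → ℕ) (n : ℕ) :
    ((List.range n).map g).sum = ∑ i ∈ Finset.range n, g i := by
  induction n with
  | zero => simp
  | succ n ih => rw [List.range_succ, Finset.sum_range_succ, ← ih]; simp

def skCnt (n : ℕ) : ℕ → List ℕ → ℕ → ℕ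
  | 0, ds, _ => 2 ^ ds.length * ds.length.factorial
  | _ + 1, [], _ => 1
  | f + 1, d :: ds, U =>
    ((List.range n).map (fun a =>
      if U.testBit a || U.testBit ((a + d) % n) then 0
      else skCnt n f ds (U ||| 2 ^ a ||| 2 ^ ((a + d) % n)))).sum

def skSols (n : ℕ) [NeZero n] : Finset (ZMod n) → List ℕ → Finset (List (ZMod n))
  | _, [] => {[]}
  | U, d :: ds =>
    (Finset.univ.filter (fun a : ZMod n => a ∉ U ∧ a + (d : ZMod n) ∉ U)).biUnion
      (fun a => (skSols n (insert a (insert (a + (d : ZMod n)) U)) ds).image (fun l => a :: l))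

theorem skCompl_card {n : ℕ} [NeZero n] {U : Finset (ZMod n)} {a : ZMod n} {d r : ℕ}
    (hd : 0 < d ∧ d < n) (ha : a ∉ U ∧ a + (d : ZMod n) ∉ U) (h : Uᶜ.card ≤ 2 * (r + 1)) :
    (insert a (insert (a + (d : ZMod n)) U))ᶜ.card ≤ 2 * r := by
  have hne : a ≠ a + (d : ZMod n) := by
    intro h
    have h0 : (d : ZMod n) = 0 := by
      simpa using h.symm
    rw [ZMod.natCast_eq_zero_iff] at h0
    exact absurd (Nat.le_of_dvd hd.1 h0) (by omega)
  rw [Finset.card_compl] at *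
  rw [Finset.card_insert_of_notMem (by simp [hne, ha.1]), Finset.card_insert_of_notMem ha.2]
  omega

theorem skCrude (n : ℕ) [NeZero n] : ∀ (ds : List ℕ) (U : Finset (ZMod n)),
    (∀ d ∈ ds, 0 < d ∧ d < n) → Uᶜ.card ≤ 2 * ds.length →
    (skSols n U ds).card ≤ 2 ^ ds.length * ds.length.factorial := by
  intro ds
  induction ds with
  | nil => intro U _ _; simp [skSols]
  | cons d ds ih =>
    intro U hds hU
    rw [skSols]
    refine (Finset.card_biUnion_le_card_mul _ _ (2 ^ ds.length * ds.length.factorial) ?_).trans ?_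
    · intro a ha
      refine Finset.card_image_le.trans (ih _ (fun e he => hds e (by simp [he])) ?_)
      exact skCompl_card (hds d (by simp)) (by simpa using ha) (by simpa using hU)
    · have h1 : (Finset.univ.filter
          (fun a : ZMod n => a ∉ U ∧ a + (d : ZMod n) ∉ U)).card ≤ 2 * (ds.length + 1) := by
        refine (Finset.card_le_card ?_).trans (by simpa using hU)
        intro a ha
        simp at ha ⊢
        exact ha.1
      calc _ ≤ 2 * (ds.length + 1) * (2 ^ ds.length * ds.length.factorial) :=
            Nat.mul_le_mul_right _ h1
        _ = _ := by
            rw [List.length_cons, Nat.factorial_succ, pow_succ]; ring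

theorem skCard_le_cnt (n : ℕ) [NeZero n] : ∀ (f : ℕ) (ds : List ℕ) (U : Finset (ZMod n)) (M : ℕ),
    (∀ z : ZMod n, z ∈ U ↔ M.testBit z.val = true) →
    (∀ d ∈ ds, 0 < d ∧ d < n) → Uᶜ.card ≤ 2 * ds.length →
    (skSols n U ds).card ≤ skCnt n f ds M := by
  intro f
  induction f with
  | zero => intro ds U M _ h1 h2; rw [skCnt]; exact skCrude n ds U h1 h2
  | succ f ih =>
    intro ds U M hM hds hU
    cases ds with
    | nil => simp [skSols, skCnt]
    | cons d ds =>
      rw [skSols, skCnt]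
      refine Finset.card_biUnion_le.trans ?_
      have hval : ∀ a : ZMod n, (a + (d : ZMod n)).val = (a.val + d) % n := by
        intro a
        rw [ZMod.val_add, ZMod.val_natCast]
        simp
      have hs : ∀ g : ℕ → ℕ, ((List.range n).map g).sum = ∑ a : ZMod n, g a.val := by
        intro g
        rw [skListSum]
        refine Finset.sum_nbij' (fun i => (i : ZMod n)) ZMod.val ?_ ?_ ?_ ?_ ?_
        · intro i _; simp
        · intro z _; simpa using z.val_lt
        · intro i hi; exact ZMod.val_natCast_of_lt (by simpa using hi)
        · intro z _; simp
        · intro i hi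
          rw [ZMod.val_natCast_of_lt (by simpa using hi)]
      rw [hs, Finset.sum_filter]
      refine Finset.sum_le_sum fun a _ => ?_
      rw [← hval]
      by_cases h : a ∉ U ∧ a + (d : ZMod n) ∉ U
      · rw [if_pos h]
        have h1 := h.1
        have h2 := h.2
        rw [hM] at h1 h2
        rw [if_neg (by simp [h1, h2])]
        refine Finset.card_image_le.trans (ih _ _ _ ?_ (fun e he => hds e (by simp [he])) ?_)
        · intro z
          have e1 : z = a ↔ a.val = z.val := by
            rw [(ZMod.val_injective n).eq_iff, eq_comm]
          have e2 : z = a + (d : ZMod n) ↔ (a + (d : ZMod n)).val = z.val := by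
            rw [(ZMod.val_injective n).eq_iff, eq_comm]
          simp only [Finset.mem_insert, Nat.testBit_or, Nat.testBit_two_pow, Bool.or_eq_true,
            decide_eq_true_eq, e1, e2, hM]
          tauto
        · exact skCompl_card (hds d (by simp)) h (by simpa using hU)
      · rw [if_neg h]; exact Nat.zero_le _

theorem skMem {m : ℕ} [NeZero (2 * m)] {a b : Fin m → ZMod (2 * m)} (h : IsSkolemCircle m a b) :
    ∀ (is : List (Fin m)) (U : Finset (ZMod (2 * m))), is.Nodup →
      (∀ i ∈ is, a i ∉ U ∧ b i ∉ U) →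
      is.map a ∈ skSols (2 * m) U (is.map (fun i : Fin m => (i : ℕ) + 1)) := by
  intro is
  induction is with
  | nil => intro U _ _; simp [skSols]
  | cons i is ih =>
    intro U hn hU
    have hb : a i + (((i : ℕ) + 1 : ℕ) : ZMod (2 * m)) = b i := by
      rw [← h.2 i]; ring
    rw [List.map_cons, List.map_cons, skSols, Finset.mem_biUnion]
    refine ⟨a i, ?_, ?_⟩
    · rw [Finset.mem_filter, hb]
      exact ⟨Finset.mem_univ _, hU i (by simp)⟩
    · rw [hb]
      refine Finset.mem_image_of_mem _ (ih _ (List.nodup_cons.1 hn).2 ?_)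
      intro j hj
      have hij : j ≠ i := by
        rintro rfl
        exact (List.nodup_cons.1 hn).1 hj
      have hj' := hU j (by simp [hj])
      have k1 : a j ≠ a i := fun e => hij (by simpa using @h.1 (Sum.inl j) (Sum.inl i) e)
      have k2 : a j ≠ b i := fun e => by simpa using @h.1 (Sum.inl j) (Sum.inr i) e
      have k3 : b j ≠ a i := fun e => by simpa using @h.1 (Sum.inr j) (Sum.inl i) e
      have k4 : b j ≠ b i := fun e => hij (by simpa using @h.1 (Sum.inr j) (Sum.inr i) e)
      simp [k1, k2, k3, k4, hj'.1, hj'.2]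

def skTotal (m f : ℕ) : ℕ :=
  ((List.range (m - 2)).map (fun k => skCnt (2 * m) f ((List.range (m - 2)).map (fun j => j + 3))
    (2 ^ 1 ||| 2 ^ 2 ||| 2 ^ (k + 3) ||| 2 ^ (k + 5)))).sum

theorem skBound (m : ℕ) (hm : 5 ≤ m) (z0 : 0 < m) (z1 : 1 < m) (f : ℕ) :
    {p : (Fin m → ZMod (2 * m)) × (Fin m → ZMod (2 * m)) |
        IsSkolemCircle m p.1 p.2 ∧
        p.1 ⟨0, z0⟩ = 1 ∧ p.2 ⟨0, z0⟩ = 2 ∧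
        3 ≤ (p.1 ⟨1, z1⟩).val ∧ (p.1 ⟨1, z1⟩).val ≤ m}.ncard
      ≤ skTotal m f := by
  classical
  have : NeZero (2 * m) := ⟨by omega⟩
  let rest : List (Fin m) := List.ofFn (fun j : Fin (m - 2) => (⟨(j : ℕ) + 2, by omega⟩ : Fin m))
  let ds : List ℕ := (List.range (m - 2)).map (fun j => j + 3)
  have hds : rest.map (fun i : Fin m => (i : ℕ) + 1) = ds := by
    apply List.ext_getElem
    · simp [rest, ds]
    · intro i h1 h2
      simp [rest, ds]
  have hlen : ds.length = m - 2 := by simp [ds]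
  have hrest : ∀ i : Fin m, i ∈ rest ↔ 2 ≤ (i : ℕ) := by
    intro i
    simp only [rest, List.mem_ofFn]
    constructor
    · rintro ⟨j, rfl⟩; simp
    · intro h
      exact ⟨⟨(i : ℕ) - 2, by omega⟩, by ext; simp; omega⟩
  have hnd : rest.Nodup := by
    rw [List.nodup_ofFn]
    intro x y hxy
    simp at hxy
    ext; omega
  let V : ℕ → Finset (ZMod (2 * m)) := fun k => {((1 : ℕ) : ZMod (2 * m)), ((2 : ℕ) : ZMod (2 * m)),
    ((k + 3 : ℕ) : ZMod (2 * m)), ((k + 5 : ℕ) : ZMod (2 * m))}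
  let T : Finset (ℕ × List (ZMod (2 * m))) := (Finset.range (m - 2)).biUnion
    (fun k => (skSols (2 * m) (V k) ds).image (fun l => (k, l)))
  have hcast : ∀ x y : ℕ, x < 2 * m → y < 2 * m →
      ((x : ZMod (2 * m)) = (y : ZMod (2 * m)) ↔ x = y) := by
    intro x y hx hy
    constructor
    · intro h
      have := congrArg ZMod.val h
      rwa [ZMod.val_natCast_of_lt hx, ZMod.val_natCast_of_lt hy] at this
    · rintro rfl; rfl
  have hT : T.card ≤ skTotal m f := by
    refine Finset.card_biUnion_le.trans ?_
    have : skTotal m f = ∑ k ∈ Finset.range (m - 2), skCnt (2 * m) f ds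
        (2 ^ 1 ||| 2 ^ 2 ||| 2 ^ (k + 3) ||| 2 ^ (k + 5)) := skListSum _ _
    rw [this]
    refine Finset.sum_le_sum fun k hk => ?_
    rw [Finset.mem_range] at hk
    refine Finset.card_image_le.trans (skCard_le_cnt _ _ _ _ _ ?_ ?_ ?_)
    · intro z
      obtain ⟨x, hx, rfl⟩ : ∃ x : ℕ, x < 2 * m ∧ (x : ZMod (2 * m)) = z :=
        ⟨z.val, z.val_lt, by simp⟩
      simp only [V, Finset.mem_insert, Finset.mem_singleton]
      rw [hcast _ _ hx (by omega), hcast _ _ hx (by omega), hcast _ _ hx (by omega),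
        hcast _ _ hx (by omega), ZMod.val_natCast_of_lt hx]
      simp only [Nat.testBit_or, Nat.testBit_two_pow, Bool.or_eq_true, decide_eq_true_eq]
      omega
    · intro d hd
      simp only [ds, List.mem_map, List.mem_range] at hd
      omega
    · have : (V k).card = 4 := by
        simp only [V]
        rw [Finset.card_insert_of_notMem, Finset.card_insert_of_notMem,
          Finset.card_insert_of_notMem, Finset.card_singleton]
        all_goals
          simp only [Finset.mem_insert, Finset.mem_singleton]
          repeat rw [hcast _ _ (by omega) (by omega)]
          omega
      rw [Finset.card_compl, this, ZMod.card, hlen]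
      omega
  refine le_trans ?_ hT
  rw [← Set.ncard_coe_finset]
  refine Set.ncard_le_ncard_of_injOn
    (fun p => ((p.1 ⟨1, z1⟩).val - 3, rest.map p.1)) ?_ ?_ (Finset.finite_toSet T)
  · rintro ⟨a, b⟩ ⟨h, h0, h0', h1, h1'⟩
    simp only at h h0 h0' h1 h1'
    have ha1 : (((a ⟨1, z1⟩).val - 3 + 3 : ℕ) : ZMod (2 * m)) = a ⟨1, z1⟩ := by
      rw [Nat.sub_add_cancel h1]; simp
    have hb1 : (((a ⟨1, z1⟩).val - 3 + 5 : ℕ) : ZMod (2 * m)) = b ⟨1, z1⟩ := by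
      have := h.2 ⟨1, z1⟩
      rw [sub_eq_iff_eq_add, ← ha1] at this
      rw [this]
      push_cast
      ring
    rw [Finset.mem_coe, Finset.mem_biUnion]
    refine ⟨(a ⟨1, z1⟩).val - 3, by rw [Finset.mem_range]; omega,
      Finset.mem_image_of_mem _ ?_⟩
    rw [← hds]
    refine skMem h rest _ hnd ?_
    intro j hj
    rw [hrest] at hj
    simp only [V]
    rw [ha1, hb1, Nat.cast_one, Nat.cast_ofNat, ← h0, ← h0']
    have hj0 : j ≠ ⟨0, z0⟩ := by intro e; rw [e] at hj; simp at hj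
    have hj1 : j ≠ ⟨1, z1⟩ := by intro e; rw [e] at hj; simp at hj
    have k1 : ∀ i, j ≠ i → a j ≠ a i :=
      fun i hij e => hij (by simpa using @h.1 (Sum.inl j) (Sum.inl i) e)
    have k2 : ∀ i, a j ≠ b i := fun i e => by simpa using @h.1 (Sum.inl j) (Sum.inr i) e
    have k3 : ∀ i, b j ≠ a i := fun i e => by simpa using @h.1 (Sum.inr j) (Sum.inl i) e
    have k4 : ∀ i, j ≠ i → b j ≠ b i :=
      fun i hij e => hij (by simpa using @h.1 (Sum.inr j) (Sum.inr i) e)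
    simp [k1 _ hj0, k1 _ hj1, k2, k3, k4 _ hj0, k4 _ hj1]
  · rintro ⟨a, b⟩ ⟨h, h0, h0', h1, h1'⟩ ⟨a', b'⟩ ⟨g, g0, g0', g1, g1'⟩ he
    simp only [Prod.mk.injEq] at h h0 h0' h1 h1' g g0 g0' g1 g1' he
    have haa : a = a' := by
      funext i
      by_cases hi : 2 ≤ (i : ℕ)
      · exact List.map_inj_left.1 he.2 i ((hrest i).2 hi)
      · by_cases hi0 : (i : ℕ) = 0
        · have : i = ⟨0, z0⟩ := Fin.ext hi0
          rw [this, h0, g0]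
        · have : i = ⟨1, z1⟩ := Fin.ext (by simp; omega)
          rw [this]
          exact ZMod.val_injective _ (by omega)
    have hbb : b = b' := by
      funext i
      have e1 := h.2 i
      have e2 := g.2 i
      rw [sub_eq_iff_eq_add] at e1 e2
      rw [e1, e2, haa]
    rw [haa, hbb]

theorem skFact (j : ℕ) : 4 * (j + 10).factorial ≤ (j + 11) ^ (j + 7) := by
  induction j with
  | zero => decide +kernel
  | succ j ih =>
    calc 4 * (j + 1 + 10).factorial = (j + 11) * (4 * (j + 10).factorial) := by
          rw [show j + 1 + 10 = (j + 10) + 1 by ring, Nat.factorial_succ]; ring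
      _ ≤ (j + 11) * (j + 11) ^ (j + 7) := Nat.mul_le_mul_left _ ih
      _ = (j + 11) ^ (j + 8) := by ring
      _ ≤ (j + 1 + 11) ^ (j + 1 + 7) := by
          rw [show j + 1 + 7 = j + 8 by ring]
          exact Nat.pow_le_pow_left (by omega) _

theorem skLarge (m : ℕ) (hm : 12 ≤ m) :
    skTotal m 0 ≤ 2 * (m - 2) * (2 * m - 2) ^ (m - 5) := by
  obtain ⟨j, rfl⟩ := Nat.exists_eq_add_of_le' hm
  have := skFact j
  simp only [skTotal, skCnt, List.length_map, List.length_range, List.map_const',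
    List.sum_replicate, smul_eq_mul]
  rw [show j + 12 - 2 = j + 10 by omega, show 2 * (j + 12) - 2 = 2 * (j + 11) by omega,
    show j + 12 - 5 = j + 7 by omega, mul_pow]
  calc (j + 10) * (2 ^ (j + 10) * (j + 10).factorial)
      = 2 * (j + 10) * 2 ^ (j + 7) * (4 * (j + 10).factorial) := by ring
    _ ≤ 2 * (j + 10) * 2 ^ (j + 7) * (j + 11) ^ (j + 7) := Nat.mul_le_mul_left _ this
    _ = _ := by ring

/-- The number of Skolem circles of order `m ≥ 5` in standard positional
labeling (`(a₁,b₁) = (1,2)` and `3 ≤ a₂ ≤ m`) is at most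
`2(m-2)(2m-2)^(m-5)`. -/
theorem skolemCircle_count_upper_bound (m : ℕ) (hm : 5 ≤ m) :
    {p : (Fin m → ZMod (2 * m)) × (Fin m → ZMod (2 * m)) |
        IsSkolemCircle m p.1 p.2 ∧
        p.1 ⟨0, by omega⟩ = 1 ∧ p.2 ⟨0, by omega⟩ = 2 ∧
        3 ≤ (p.1 ⟨1, by omega⟩).val ∧ (p.1 ⟨1, by omega⟩).val ≤ m}.ncard
      ≤ 2 * (m - 2) * (2 * m - 2) ^ (m - 5) := by
  by_cases h : 12 ≤ m
  · exact (skBound m hm (by omega) (by omega) 0).trans (skLarge m h)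
  · by_cases h9 : m ≤ 9
    · refine (skBound m hm (by omega) (by omega) 4).trans ?_
      clear h
      interval_cases m <;> decide +kernel
    · refine (skBound m hm (by omega) (by omega) 3).trans ?_
      have h10 : 10 ≤ m := by omega
      have h11 : m ≤ 11 := by omega
      clear h h9 hm
      interval_cases m <;> decide +kernel
end

section
/- For m ≥ 8 with m ≡ 0 or 1 (mod 4), the number of circle-equivalence classes of Skolem circles of order m is at least 2^{⌊m/3⌋−1}/(2 + log₂ m) + 1. -/
/-- The conclusion of the main theorem, as a predicate. -/
def Goal (m : ℕ) : Prop :=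
    ∃ S : Set ((Fin m → ZMod (2 * m)) × (Fin m → ZMod (2 * m))),
      (∀ p ∈ S, IsSkolemCircle m p.1 p.2) ∧
      (∀ p ∈ S, ∀ q ∈ S, CircleEquiv m p q → p = q) ∧
      (2 : ℝ) ^ (m / 3 - 1) / (2 + Real.logb 2 m) + 1 ≤ S.ncard

/-- Block `g` consists of the symbols `3g, 3g+1, 3g+2`. -/
def Blk (p q t g : ℕ) : Prop :=
  (g % 2 = 1 ∧ g < 2 * p) ∨ (g % 2 = 0 ∧ 2 ≤ g ∧ g ≤ 2 * q ∧ g ≠ 2 * t + 2)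

instance (p q t g : ℕ) : Decidable (Blk p q t g) := by unfold Blk; infer_instance

/-- Start of the left triple of cells of block `g`. -/
def XS (p q t J g : ℕ) : ℕ :=
  if g % 2 = 1 then 3 * (p - 1 - g / 2)
  else if g < 2 * t + 2 then 6 * p + 1 + J + 3 * (q - g / 2) - 1
  else 6 * p + 1 + J + 3 * (q - g / 2)

def pos (p q t J : ℕ) (A : ℕ → ℕ) (E : Finset ℕ) (d : ℕ) : ℕ :=
  if Blk p q t (d / 3) then
    XS p q t J (d / 3) + (d % 3 + 1 + if d / 3 ∈ E then 1 else 0) % 3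
  else A d

def BS (p q t : ℕ) : Finset ℕ :=
  (Finset.range p).image (fun i => 2 * i + 1) ∪
    ((Finset.range q).erase t).image (fun i => 2 * i + 2)

theorem BS_card (p q t : ℕ) (ht : t < q) : (BS p q t).card = p + (q - 1) := by
  unfold BS
  rw [Finset.card_union_of_disjoint, Finset.card_image_of_injective, Finset.card_image_of_injective,
    Finset.card_erase_of_mem (by simpa using ht), Finset.card_range, Finset.card_range]
  · intro a b h; simp at h; exact h
  · intro a b h; simp at h; exact h
  · rw [Finset.disjoint_left]
    intro x hx hy
    simp only [Finset.mem_image] at hx hy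
    obtain ⟨i, -, rfl⟩ := hx
    obtain ⟨j, -, h⟩ := hy
    omega

theorem BS_blk (p q t g : ℕ) (hg : g ∈ BS p q t) : Blk p q t g := by
  unfold BS at hg
  simp only [Finset.mem_union, Finset.mem_image, Finset.mem_range, Finset.mem_erase] at hg
  unfold Blk
  rcases hg with ⟨i, hi, rfl⟩ | ⟨i, ⟨h1, hi⟩, rfl⟩ <;> omega

theorem cover_left (p q t J m : ℕ) (A : ℕ → ℕ) (E : Finset ℕ) (g e : ℕ) (hg : Blk p q t g)
    (he : e < 3) (hm : 3 * g + 2 ≤ m) (v : ℕ) (hv : v = XS p q t J g + e) :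
    ∃ d, 1 ≤ d ∧ d ≤ m ∧ v = pos p q t J A E d := by
  have h1 : 1 ≤ g := by unfold Blk at hg; omega
  have hr : ∃ r, r < 3 ∧ (r + 1 + if g ∈ E then 1 else 0) % 3 = e := by
    split_ifs
    · exact ⟨(e + 1) % 3, by omega, by omega⟩
    · exact ⟨(e + 2) % 3, by omega, by omega⟩
  obtain ⟨r, hr3, hr⟩ := hr
  have e1 : (3 * g + r) / 3 = g := by omega
  have e2 : (3 * g + r) % 3 = r := by omega
  refine ⟨3 * g + r, by omega, by omega, ?_⟩
  unfold pos
  rw [e1, e2, if_pos hg, hr, hv]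

theorem cover_right (p q t J m : ℕ) (A : ℕ → ℕ) (E : Finset ℕ) (g e : ℕ) (hg : Blk p q t g)
    (he : e < 3) (hm : 3 * g + 2 ≤ m) (v : ℕ) (hv : v = XS p q t J g + 3 * g + 1 + e) :
    ∃ d, 1 ≤ d ∧ d ≤ m ∧ v = pos p q t J A E d + d := by
  have h1 : 1 ≤ g := by unfold Blk at hg; omega
  have hr : ∃ r, r < 3 ∧ (r + 1 + if g ∈ E then 1 else 0) % 3 + r = e + 1 := by
    split_ifs
    · exact ⟨(4 - e) % 3, by omega, by omega⟩
    · exact ⟨(3 - e) % 3, by omega, by omega⟩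
  obtain ⟨r, hr3, hr⟩ := hr
  have e1 : (3 * g + r) / 3 = g := by omega
  have e2 : (3 * g + r) % 3 = r := by omega
  refine ⟨3 * g + r, by omega, by omega, ?_⟩
  unfold pos
  rw [e1, e2, if_pos hg, hv]
  omega

/-- The cells not covered by blocks. -/
def PC (m p q t J v : ℕ) : Prop :=
  v = 3 * p ∨ (6 * p + 1 ≤ v ∧ v < 6 * p + 1 + J) ∨
  (6 * p + 1 + J + 3 * (q - 1 - t) ≤ v ∧ v < 6 * p + 1 + J + 3 * (q - t) - 1) ∨
  (6 * p + 1 + J + 3 * q - 1 ≤ v ∧ v < 6 * p + 1 + J + 3 * q + 3) ∨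
  (6 * p + 1 + J + 3 * q + 3 + 3 * t ≤ v ∧ v < 6 * p + 1 + J + 3 * q + 7 + 3 * t) ∨
  (6 * p + 1 + J + 6 * q + 4 ≤ v ∧ v < 2 * m)

theorem cover (m p q t J : ℕ) (A : ℕ → ℕ) (E : Finset ℕ) (ht : t < q)
    (hp : 6 * p ≤ m + 1) (hq : 6 * q + 2 ≤ m)
    (hA : ∀ v, PC m p q t J v → ∃ d, 1 ≤ d ∧ d ≤ m ∧ ¬ Blk p q t (d / 3) ∧
      (v = A d ∨ v = A d + d ∨ v + 2 * m = A d + d)) (v : ℕ) (hv : v < 2 * m) :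
    ∃ d, 1 ≤ d ∧ d ≤ m ∧ (v = pos p q t J A E d ∨ v = pos p q t J A E d + d ∨
      v + 2 * m = pos p q t J A E d + d) := by
  by_cases hP : PC m p q t J v
  · obtain ⟨d, h1, h2, h3, h4⟩ := hA v hP
    refine ⟨d, h1, h2, ?_⟩
    unfold pos
    rwa [if_neg h3]
  have L : ∀ g e, Blk p q t g → e < 3 → 3 * g + 2 ≤ m → v = XS p q t J g + e → 
      ∃ d, 1 ≤ d ∧ d ≤ m ∧ (v = pos p q t J A E d ∨ v = pos p q t J A E d + d ∨
      v + 2 * m = pos p q t J A E d + d) := by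
    intro g e a b c d
    obtain ⟨d, x, y, z⟩ := cover_left p q t J m A E g e a b c v d
    exact ⟨d, x, y, Or.inl z⟩
  have R : ∀ g e, Blk p q t g → e < 3 → 3 * g + 2 ≤ m → v = XS p q t J g + 3 * g + 1 + e → 
      ∃ d, 1 ≤ d ∧ d ≤ m ∧ (v = pos p q t J A E d ∨ v = pos p q t J A E d + d ∨
      v + 2 * m = pos p q t J A E d + d) := by
    intro g e a b c d
    obtain ⟨d, x, y, z⟩ := cover_right p q t J m A E g e a b c v d
    exact ⟨d, x, y, Or.inr (Or.inl z)⟩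
  have X1 : ∀ i, i < p → XS p q t J (2 * i + 1) = 3 * (p - 1 - i) := by
    intro i hi; unfold XS; rw [if_pos (by omega)]; congr 2; omega
  have X2 : ∀ i, i < t → XS p q t J (2 * i + 2) = 6 * p + 1 + J + 3 * (q - 1 - i) - 1 := by
    intro i hi; unfold XS; rw [if_neg (by omega), if_pos (by omega)]; omega
  have X3 : ∀ i, t < i → i < q → XS p q t J (2 * i + 2) = 6 * p + 1 + J + 3 * (q - 1 - i) := by
    intro i hi hi2; unfold XS; rw [if_neg (by omega), if_neg (by omega)]; omega
  have B1 : ∀ i, i < p → Blk p q t (2 * i + 1) := by intro i hi; unfold Blk; omega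
  have B2 : ∀ i, i < q → i ≠ t → Blk p q t (2 * i + 2) := by intro i hi hi2; unfold Blk; omega
  unfold PC at hP
  have cases : v < 3 * p ∨ (3 * p + 1 ≤ v ∧ v < 6 * p + 1) ∨
      (6 * p + 1 + J ≤ v ∧ v < 6 * p + 1 + J + 3 * (q - 1 - t)) ∨
      (6 * p + 1 + J + 3 * (q - t) - 1 ≤ v ∧ v < 6 * p + 1 + J + 3 * q - 1) ∨
      (6 * p + 1 + J + 3 * q + 3 ≤ v ∧ v < 6 * p + 1 + J + 3 * q + 3 + 3 * t) ∨
      (6 * p + 1 + J + 3 * q + 7 + 3 * t ≤ v ∧ v < 6 * p + 1 + J + 6 * q + 4) := by omega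
  clear hP hA
  rcases cases with h | h | h | h | h | h
  · obtain ⟨i, hi⟩ : ∃ i, i = p - 1 - v / 3 := ⟨_, rfl⟩
    have := X1 i (by omega)
    exact L (2 * i + 1) (v % 3) (B1 i (by omega)) (by omega) (by omega) (by omega)
  · obtain ⟨i, hi⟩ : ∃ i, i = (v - 3 * p - 1) / 3 := ⟨_, rfl⟩
    have := X1 i (by omega)
    exact R (2 * i + 1) ((v - 3 * p - 1) % 3) (B1 i (by omega)) (by omega) (by omega) (by omega)
  · obtain ⟨w, hw⟩ : ∃ w, v = 6 * p + 1 + J + w := ⟨v - (6 * p + 1 + J), by omega⟩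
    obtain ⟨i, hi⟩ : ∃ i, i = q - 1 - w / 3 := ⟨_, rfl⟩
    have := X3 i (by omega) (by omega)
    exact L (2 * i + 2) (w % 3) (B2 i (by omega) (by omega)) (by omega) (by omega) (by omega)
  · obtain ⟨w, hw⟩ : ∃ w, v + 1 = 6 * p + 1 + J + w := ⟨v + 1 - (6 * p + 1 + J), by omega⟩
    obtain ⟨i, hi⟩ : ∃ i, i = q - 1 - w / 3 := ⟨_, rfl⟩
    have := X2 i (by omega)
    exact L (2 * i + 2) (w % 3) (B2 i (by omega) (by omega)) (by omega) (by omega) (by omega)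
  · obtain ⟨w, hw⟩ : ∃ w, v = 6 * p + 1 + J + 3 * q + 3 + w :=
      ⟨v - (6 * p + 1 + J + 3 * q + 3), by omega⟩
    obtain ⟨i, hi⟩ : ∃ i, i = w / 3 := ⟨_, rfl⟩
    have := X2 i (by omega)
    exact R (2 * i + 2) (w % 3) (B2 i (by omega) (by omega)) (by omega) (by omega) (by omega)
  · obtain ⟨w, hw⟩ : ∃ w, v = 6 * p + 1 + J + 3 * q + 4 + w :=
      ⟨v - (6 * p + 1 + J + 3 * q + 4), by omega⟩
    obtain ⟨i, hi⟩ : ∃ i, i = w / 3 := ⟨_, rfl⟩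
    have := X3 i (by omega) (by omega)
    exact R (2 * i + 2) (w % 3) (B2 i (by omega) (by omega)) (by omega) (by omega) (by omega)

/-- The circle attached to a position function. -/
def circ (m : ℕ) (f : ℕ → ℕ) : (Fin m → ZMod (2 * m)) × (Fin m → ZMod (2 * m)) :=
  (fun i => (f (i + 1) : ZMod (2 * m)), fun i => (f (i + 1) : ZMod (2 * m)) + ((i + 1 : ℕ) : ZMod (2 * m)))

theorem circ_skolem (m : ℕ) (hm : 1 ≤ m) (f : ℕ → ℕ)
    (h : ∀ v, v < 2 * m → ∃ d, 1 ≤ d ∧ d ≤ m ∧ (v = f d ∨ v = f d + d ∨ v + 2 * m = f d + d)) :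
    IsSkolemCircle m (circ m f).1 (circ m f).2 := by
  have : NeZero (2 * m) := ⟨by omega⟩
  refine ⟨?_, ?_⟩
  · have hs : Function.Surjective (Sum.elim (circ m f).1 (circ m f).2) := by
      intro z
      obtain ⟨d, h1, h2, h3⟩ := h z.val (ZMod.val_lt z)
      have hz : ((z.val : ℕ) : ZMod (2 * m)) = z := ZMod.natCast_zmod_val z
      have hd : d - 1 + 1 = d := by omega
      rcases h3 with h3 | h3 | h3
      · refine ⟨Sum.inl ⟨d - 1, by omega⟩, ?_⟩
        simp only [Sum.elim_inl, circ, hd]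
        rw [← hz, h3]
      · refine ⟨Sum.inr ⟨d - 1, by omega⟩, ?_⟩
        simp only [Sum.elim_inr, circ, hd]
        rw [← hz, h3, Nat.cast_add]
      · refine ⟨Sum.inr ⟨d - 1, by omega⟩, ?_⟩
        simp only [Sum.elim_inr, circ, hd]
        rw [← Nat.cast_add, ← h3, Nat.cast_add, ZMod.natCast_self, hz, add_zero]
    have hc : Fintype.card (Fin m ⊕ Fin m) = Fintype.card (ZMod (2 * m)) := by
      rw [Fintype.card_sum, Fintype.card_fin, ZMod.card]; omega
    exact ((Fintype.bijective_iff_surjective_and_card _).2 ⟨hs, hc⟩).1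
  · intro i
    simp [circ]

theorem core (m p q t J : ℕ) (A : ℕ → ℕ) (hm8 : 8 ≤ m) (ht : t < q)
    (hp : 6 * p ≤ m + 1) (hq : 6 * q + 2 ≤ m) (hn : 1 ≤ p + (q - 1))
    (hmn : m ≤ 3 * (p + (q - 1)) + 8)
    (hA : ∀ v, PC m p q t J v → ∃ d, 1 ≤ d ∧ d ≤ m ∧ ¬ Blk p q t (d / 3) ∧
      (v = A d ∨ v = A d + d ∨ v + 2 * m = A d + d)) : Goal m := by
  set n := p + (q - 1) with hndef
  have hpos : ∀ (E : Finset ℕ) d, ¬ Blk p q t (d / 3) → pos p q t J A E d = A d := by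
    intro E d h; unfold pos; rw [if_neg h]
  have hb0 : ¬ Blk p q t 0 := by unfold Blk; omega
  have p1 : ∀ E, pos p q t J A E 1 = A 1 := fun E => hpos E 1 hb0
  have p2 : ∀ E, pos p q t J A E 2 = A 2 := fun E => hpos E 2 hb0
  have hinj : Set.InjOn (fun E => circ m (pos p q t J A E)) ((BS p q t).powerset : Set (Finset ℕ)) := by
    intro E hE F hF h
    have key : ∀ g ∈ BS p q t, g ∈ E ↔ g ∈ F := by
      intro g hg
      have hB := BS_blk p q t g hg
      have hgm : 3 * g + 2 ≤ m ∧ 1 ≤ g := by unfold Blk at hB; omega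
      have h1 := congrFun (congrArg Prod.fst h) ⟨3 * g - 1, by omega⟩
      have hd : 3 * g - 1 + 1 = 3 * g := by omega
      have e1 : 3 * g / 3 = g := by omega
      have e2 : 3 * g % 3 = 0 := by omega
      simp only [circ, hd, pos, e1, e2, if_pos hB] at h1
      rw [ZMod.natCast_eq_natCast_iff] at h1
      by_cases a : g ∈ E <;> by_cases b : g ∈ F <;> simp only [a, b, if_true, if_false, iff_true, iff_false, not_true] at h1 ⊢
      · exfalso
        have h2 : 2 ≡ 1 [MOD 2 * m] := Nat.ModEq.add_left_cancel' _ h1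
        unfold Nat.ModEq at h2
        rw [Nat.mod_eq_of_lt (by omega), Nat.mod_eq_of_lt (by omega)] at h2
        omega
      · exfalso
        have h2 : 1 ≡ 2 [MOD 2 * m] := Nat.ModEq.add_left_cancel' _ h1
        unfold Nat.ModEq at h2
        rw [Nat.mod_eq_of_lt (by omega), Nat.mod_eq_of_lt (by omega)] at h2
        omega
    have hE' := Finset.mem_powerset.1 (Finset.mem_coe.1 hE)
    have hF' := Finset.mem_powerset.1 (Finset.mem_coe.1 hF)
    ext g
    exact ⟨fun x => (key g (hE' x)).1 x, fun x => (key g (hF' x)).2 x⟩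
  refine ⟨(fun E => circ m (pos p q t J A E)) '' ((BS p q t).powerset : Set (Finset ℕ)), ?_, ?_, ?_⟩
  · rintro _ ⟨E, -, rfl⟩
    exact circ_skolem m (by omega) _ (cover m p q t J A E ht hp hq hA)
  · rintro _ ⟨E, -, rfl⟩ _ ⟨F, -, rfl⟩ ⟨x, hx | hx⟩
    · have h0 := (hx ⟨0, by omega⟩).1
      simp only [circ, zero_add, p1] at h0
      have hx0 : x = 0 := by simpa using h0
      subst hx0
      refine Prod.ext ?_ ?_
      · funext i; simpa using (hx i).1.symm
      · funext i; simpa using (hx i).2.symm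
    · exfalso
      have h0 := (hx ⟨0, by omega⟩).1
      have h1 := (hx ⟨1, by omega⟩).1
      simp only [circ, zero_add, p1, p2, Nat.reduceAdd] at h0 h1
      have h2 : ((A 1 + (A 1 + 1) : ℕ) : ZMod (2 * m)) = ((A 2 + (A 2 + 2) : ℕ) : ZMod (2 * m)) := by
        push_cast at h0 h1 ⊢
        linear_combination h0 - h1
      rw [ZMod.natCast_eq_natCast_iff] at h2
      have h3 : A 1 + (A 1 + 1) ≡ A 2 + (A 2 + 2) [MOD 2] := h2.of_mul_right m
      unfold Nat.ModEq at h3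
      omega
  · rw [hinj.ncard_image, Set.ncard_coe_finset, Finset.card_powerset, BS_card p q t ht, ← hndef]
    have hl : (3 : ℝ) ≤ Real.logb 2 m := by
      rw [Real.le_logb_iff_rpow_le (by norm_num) (by positivity)]
      have : (8 : ℝ) ≤ m := by exact_mod_cast hm8
      norm_num; exact_mod_cast this
    have h1 : (2 : ℝ) ^ (m / 3 - 1) ≤ 2 ^ (n + 1) := pow_le_pow_right₀ (by norm_num) (by omega)
    have h2 : (2 : ℝ) ≤ 2 ^ n := by
      calc (2 : ℝ) = 2 ^ 1 := by norm_num
        _ ≤ 2 ^ n := pow_le_pow_right₀ (by norm_num) hn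
    have h3 : (2 : ℝ) ^ (m / 3 - 1) / (2 + Real.logb 2 m) ≤ 2 ^ (n + 1) / 5 := by
      apply div_le_div₀ (by positivity) h1 (by norm_num) (by linarith)
    rw [pow_succ] at h3
    push_cast
    linarith

theorem inst_eight : Goal 8 := by
  have hl : (3 : ℝ) ≤ Real.logb 2 (8 : ℕ) := by
    rw [Real.le_logb_iff_rpow_le (by norm_num) (by positivity)]
    norm_num
  have key : ∃ C D : (Fin 8 → ZMod (2 * 8)) × (Fin 8 → ZMod (2 * 8)),
      IsSkolemCircle 8 C.1 C.2 ∧ IsSkolemCircle 8 D.1 D.2 ∧ ¬ CircleEquiv 8 C D ∧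
      ¬ CircleEquiv 8 D C := by
    refine ⟨(![12, 4, 11, 15, 5, 1, 2, 0], ![13, 6, 14, 3, 10, 7, 9, 8]),
      (![4, 12, 10, 15, 6, 1, 2, 0], ![5, 14, 13, 3, 11, 7, 9, 8]), ?_, ?_, ?_, ?_⟩
    · unfold IsSkolemCircle Function.Injective; decide +kernel
    · unfold IsSkolemCircle Function.Injective; decide +kernel
    · unfold CircleEquiv; decide +kernel
    · unfold CircleEquiv; decide +kernel
  obtain ⟨C, D, hC, hD, h1, h2⟩ := key
  have hne : C ≠ D := by
    rintro rfl
    exact h1 ⟨0, Or.inl fun i => by simp⟩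
  refine ⟨{C, D}, ?_, ?_, ?_⟩
  · rintro p (rfl | rfl) <;> assumption
  · rintro p (rfl | rfl) q (rfl | rfl) h
    · rfl
    · exact absurd h h1
    · exact absurd h h2
    · rfl
  · rw [Set.ncard_pair hne]
    have h3 : (2 : ℝ) ^ (8 / 3 - 1) / (2 + Real.logb 2 (8 : ℕ)) ≤ 2 / 5 := by
      apply div_le_div₀ (by norm_num) (by norm_num) (by norm_num) (by linarith)
    push_cast at h3 ⊢
    linarith

def patch0 (k d : ℕ) : ℕ :=
  if d = 12*k+0 then 6*k+0 else if d = 1 then 18*k-3 else if d = 6*k+0 then 18*k-1 else if d = 2 then 21*k-2 else if d = 6*k+1 then 15*k-2 else if d = 6*k+2 then 15*k-1 else 0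

set_option maxHeartbeats 1000000 in
theorem inst0 (k : ℕ) (hk : 1 ≤ k) : Goal (12 * k + 0) := by
  refine core (12 * k + 0) (2*k) (2*k-1) (k-1) 0 (patch0 k) (by omega) (by omega) (by omega) (by omega) (by omega) (by omega) ?_
  intro v hv
  unfold PC at hv
  have h0 : patch0 k (12*k+0) = 6*k+0 := by
    unfold patch0; rw [if_pos rfl]
  have h1 : patch0 k (1) = 18*k-3 := by
    unfold patch0; rw [if_neg (by omega), if_pos rfl]
  have h2 : patch0 k (6*k+0) = 18*k-1 := by
    unfold patch0; rw [if_neg (by omega), if_neg (by omega), if_pos rfl]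
  have h3 : patch0 k (2) = 21*k-2 := by
    unfold patch0; rw [if_neg (by omega), if_neg (by omega), if_neg (by omega), if_pos rfl]
  have h4 : patch0 k (6*k+1) = 15*k-2 := by
    unfold patch0; rw [if_neg (by omega), if_neg (by omega), if_neg (by omega), if_neg (by omega), if_pos rfl]
  have h5 : patch0 k (6*k+2) = 15*k-1 := by
    unfold patch0; rw [if_neg (by omega), if_neg (by omega), if_neg (by omega), if_neg (by omega), if_neg (by omega), if_pos rfl]
  have hc : v = 6*k+0 ∨ v = 18*k+0 ∨ v = 18*k-3 ∨ v = 18*k-2 ∨ v = 18*k-1 ∨ v = 24*k-1 ∨ v = 21*k-2 ∨ v = 21*k+0 ∨ v = 15*k-2 ∨ v = 21*k-1 ∨ v = 15*k-1 ∨ v = 21*k+1 := by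
    omega
  rcases hc with h | h | h | h | h | h | h | h | h | h | h | h
  · exact ⟨12*k+0, by omega, by omega, by unfold Blk; omega, by rw [h0]; omega⟩
  · exact ⟨12*k+0, by omega, by omega, by unfold Blk; omega, by rw [h0]; omega⟩
  · exact ⟨1, by omega, by omega, by unfold Blk; omega, by rw [h1]; omega⟩
  · exact ⟨1, by omega, by omega, by unfold Blk; omega, by rw [h1]; omega⟩
  · exact ⟨6*k+0, by omega, by omega, by unfold Blk; omega, by rw [h2]; omega⟩
  · exact ⟨6*k+0, by omega, by omega, by unfold Blk; omega, by rw [h2]; omega⟩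
  · exact ⟨2, by omega, by omega, by unfold Blk; omega, by rw [h3]; omega⟩
  · exact ⟨2, by omega, by omega, by unfold Blk; omega, by rw [h3]; omega⟩
  · exact ⟨6*k+1, by omega, by omega, by unfold Blk; omega, by rw [h4]; omega⟩
  · exact ⟨6*k+1, by omega, by omega, by unfold Blk; omega, by rw [h4]; omega⟩
  · exact ⟨6*k+2, by omega, by omega, by unfold Blk; omega, by rw [h5]; omega⟩
  · exact ⟨6*k+2, by omega, by omega, by unfold Blk; omega, by rw [h5]; omega⟩

def patch1 (k d : ℕ) : ℕ :=
  if d = 12*k+1 then 6*k+0 else if d = 12*k+0 then 12*k+1 else if d = 1 then 18*k-2 else if d = 6*k+0 then 18*k+0 else if d = 2 then 21*k-1 else if d = 6*k+1 then 15*k-1 else if d = 6*k+2 then 15*k+0 else 0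

set_option maxHeartbeats 1000000 in
theorem inst1 (k : ℕ) (hk : 1 ≤ k) : Goal (12 * k + 1) := by
  refine core (12 * k + 1) (2*k) (2*k-1) (k-1) 1 (patch1 k) (by omega) (by omega) (by omega) (by omega) (by omega) (by omega) ?_
  intro v hv
  unfold PC at hv
  have h0 : patch1 k (12*k+1) = 6*k+0 := by
    unfold patch1; rw [if_pos rfl]
  have h1 : patch1 k (12*k+0) = 12*k+1 := by
    unfold patch1; rw [if_neg (by omega), if_pos rfl]
  have h2 : patch1 k (1) = 18*k-2 := by
    unfold patch1; rw [if_neg (by omega), if_neg (by omega), if_pos rfl]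
  have h3 : patch1 k (6*k+0) = 18*k+0 := by
    unfold patch1; rw [if_neg (by omega), if_neg (by omega), if_neg (by omega), if_pos rfl]
  have h4 : patch1 k (2) = 21*k-1 := by
    unfold patch1; rw [if_neg (by omega), if_neg (by omega), if_neg (by omega), if_neg (by omega), if_pos rfl]
  have h5 : patch1 k (6*k+1) = 15*k-1 := by
    unfold patch1; rw [if_neg (by omega), if_neg (by omega), if_neg (by omega), if_neg (by omega), if_neg (by omega), if_pos rfl]
  have h6 : patch1 k (6*k+2) = 15*k+0 := by
    unfold patch1; rw [if_neg (by omega), if_neg (by omega), if_neg (by omega), if_neg (by omega), if_neg (by omega), if_neg (by omega), if_pos rfl]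
  have hc : v = 6*k+0 ∨ v = 18*k+1 ∨ v = 12*k+1 ∨ v = 24*k+1 ∨ v = 18*k-2 ∨ v = 18*k-1 ∨ v = 18*k+0 ∨ v = 24*k+0 ∨ v = 21*k-1 ∨ v = 21*k+1 ∨ v = 15*k-1 ∨ v = 21*k+0 ∨ v = 15*k+0 ∨ v = 21*k+2 := by
    omega
  rcases hc with h | h | h | h | h | h | h | h | h | h | h | h | h | h
  · exact ⟨12*k+1, by omega, by omega, by unfold Blk; omega, by rw [h0]; omega⟩
  · exact ⟨12*k+1, by omega, by omega, by unfold Blk; omega, by rw [h0]; omega⟩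
  · exact ⟨12*k+0, by omega, by omega, by unfold Blk; omega, by rw [h1]; omega⟩
  · exact ⟨12*k+0, by omega, by omega, by unfold Blk; omega, by rw [h1]; omega⟩
  · exact ⟨1, by omega, by omega, by unfold Blk; omega, by rw [h2]; omega⟩
  · exact ⟨1, by omega, by omega, by unfold Blk; omega, by rw [h2]; omega⟩
  · exact ⟨6*k+0, by omega, by omega, by unfold Blk; omega, by rw [h3]; omega⟩
  · exact ⟨6*k+0, by omega, by omega, by unfold Blk; omega, by rw [h3]; omega⟩
  · exact ⟨2, by omega, by omega, by unfold Blk; omega, by rw [h4]; omega⟩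
  · exact ⟨2, by omega, by omega, by unfold Blk; omega, by rw [h4]; omega⟩
  · exact ⟨6*k+1, by omega, by omega, by unfold Blk; omega, by rw [h5]; omega⟩
  · exact ⟨6*k+1, by omega, by omega, by unfold Blk; omega, by rw [h5]; omega⟩
  · exact ⟨6*k+2, by omega, by omega, by unfold Blk; omega, by rw [h6]; omega⟩
  · exact ⟨6*k+2, by omega, by omega, by unfold Blk; omega, by rw [h6]; omega⟩

def patch4 (k d : ℕ) : ℕ :=
  if d = 12*k+3 then 24*k+6 else if d = 12*k+4 then 6*k+0 else if d = 6*k+6 then 18*k+1 else if d = 1 then 18*k+2 else if d = 2 then 21*k+5 else if d = 6*k+7 then 15*k-1 else if d = 6*k+8 then 15*k+0 else 0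

set_option maxHeartbeats 1000000 in
theorem inst4 (k : ℕ) (hk : 1 ≤ k) : Goal (12 * k + 4) := by
  refine core (12 * k + 4) (2*k) (2*k) (k) 1 (patch4 k) (by omega) (by omega) (by omega) (by omega) (by omega) (by omega) ?_
  intro v hv
  unfold PC at hv
  have h0 : patch4 k (12*k+3) = 24*k+6 := by
    unfold patch4; rw [if_pos rfl]
  have h1 : patch4 k (12*k+4) = 6*k+0 := by
    unfold patch4; rw [if_neg (by omega), if_pos rfl]
  have h2 : patch4 k (6*k+6) = 18*k+1 := by
    unfold patch4; rw [if_neg (by omega), if_neg (by omega), if_pos rfl]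
  have h3 : patch4 k (1) = 18*k+2 := by
    unfold patch4; rw [if_neg (by omega), if_neg (by omega), if_neg (by omega), if_pos rfl]
  have h4 : patch4 k (2) = 21*k+5 := by
    unfold patch4; rw [if_neg (by omega), if_neg (by omega), if_neg (by omega), if_neg (by omega), if_pos rfl]
  have h5 : patch4 k (6*k+7) = 15*k-1 := by
    unfold patch4; rw [if_neg (by omega), if_neg (by omega), if_neg (by omega), if_neg (by omega), if_neg (by omega), if_pos rfl]
  have h6 : patch4 k (6*k+8) = 15*k+0 := by
    unfold patch4; rw [if_neg (by omega), if_neg (by omega), if_neg (by omega), if_neg (by omega), if_neg (by omega), if_neg (by omega), if_pos rfl]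
  have hc : v = 24*k+6 ∨ v = 12*k+1 ∨ v = 6*k+0 ∨ v = 18*k+4 ∨ v = 18*k+1 ∨ v = 24*k+7 ∨ v = 18*k+2 ∨ v = 18*k+3 ∨ v = 21*k+5 ∨ v = 21*k+7 ∨ v = 15*k-1 ∨ v = 21*k+6 ∨ v = 15*k+0 ∨ v = 21*k+8 := by
    omega
  rcases hc with h | h | h | h | h | h | h | h | h | h | h | h | h | h
  · exact ⟨12*k+3, by omega, by omega, by unfold Blk; omega, by rw [h0]; omega⟩
  · exact ⟨12*k+3, by omega, by omega, by unfold Blk; omega, by rw [h0]; omega⟩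
  · exact ⟨12*k+4, by omega, by omega, by unfold Blk; omega, by rw [h1]; omega⟩
  · exact ⟨12*k+4, by omega, by omega, by unfold Blk; omega, by rw [h1]; omega⟩
  · exact ⟨6*k+6, by omega, by omega, by unfold Blk; omega, by rw [h2]; omega⟩
  · exact ⟨6*k+6, by omega, by omega, by unfold Blk; omega, by rw [h2]; omega⟩
  · exact ⟨1, by omega, by omega, by unfold Blk; omega, by rw [h3]; omega⟩
  · exact ⟨1, by omega, by omega, by unfold Blk; omega, by rw [h3]; omega⟩
  · exact ⟨2, by omega, by omega, by unfold Blk; omega, by rw [h4]; omega⟩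
  · exact ⟨2, by omega, by omega, by unfold Blk; omega, by rw [h4]; omega⟩
  · exact ⟨6*k+7, by omega, by omega, by unfold Blk; omega, by rw [h5]; omega⟩
  · exact ⟨6*k+7, by omega, by omega, by unfold Blk; omega, by rw [h5]; omega⟩
  · exact ⟨6*k+8, by omega, by omega, by unfold Blk; omega, by rw [h6]; omega⟩
  · exact ⟨6*k+8, by omega, by omega, by unfold Blk; omega, by rw [h6]; omega⟩

def patch5 (k d : ℕ) : ℕ :=
  if d = 12*k+2 then 6*k+3 else if d = 12*k+0 then 12*k+7 else if d = 12*k+1 then 12*k+8 else if d = 1 then 18*k+6 else if d = 6*k+0 then 18*k+8 else if d = 2 then 21*k+6 else if d = 6*k+1 then 15*k+6 else if d = 6*k+2 then 15*k+7 else 0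

set_option maxHeartbeats 1000000 in
theorem inst5 (k : ℕ) (hk : 1 ≤ k) : Goal (12 * k + 5) := by
  refine core (12 * k + 5) (2*k+1) (2*k-1) (k-1) 2 (patch5 k) (by omega) (by omega) (by omega) (by omega) (by omega) (by omega) ?_
  intro v hv
  unfold PC at hv
  have h0 : patch5 k (12*k+2) = 6*k+3 := by
    unfold patch5; rw [if_pos rfl]
  have h1 : patch5 k (12*k+0) = 12*k+7 := by
    unfold patch5; rw [if_neg (by omega), if_pos rfl]
  have h2 : patch5 k (12*k+1) = 12*k+8 := by
    unfold patch5; rw [if_neg (by omega), if_neg (by omega), if_pos rfl]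
  have h3 : patch5 k (1) = 18*k+6 := by
    unfold patch5; rw [if_neg (by omega), if_neg (by omega), if_neg (by omega), if_pos rfl]
  have h4 : patch5 k (6*k+0) = 18*k+8 := by
    unfold patch5; rw [if_neg (by omega), if_neg (by omega), if_neg (by omega), if_neg (by omega), if_pos rfl]
  have h5 : patch5 k (2) = 21*k+6 := by
    unfold patch5; rw [if_neg (by omega), if_neg (by omega), if_neg (by omega), if_neg (by omega), if_neg (by omega), if_pos rfl]
  have h6 : patch5 k (6*k+1) = 15*k+6 := by
    unfold patch5; rw [if_neg (by omega), if_neg (by omega), if_neg (by omega), if_neg (by omega), if_neg (by omega), if_neg (by omega), if_pos rfl]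
  have h7 : patch5 k (6*k+2) = 15*k+7 := by
    unfold patch5; rw [if_neg (by omega), if_neg (by omega), if_neg (by omega), if_neg (by omega), if_neg (by omega), if_neg (by omega), if_neg (by omega), if_pos rfl]
  have hc : v = 6*k+3 ∨ v = 18*k+5 ∨ v = 12*k+7 ∨ v = 24*k+7 ∨ v = 12*k+8 ∨ v = 24*k+9 ∨ v = 18*k+6 ∨ v = 18*k+7 ∨ v = 18*k+8 ∨ v = 24*k+8 ∨ v = 21*k+6 ∨ v = 21*k+8 ∨ v = 15*k+6 ∨ v = 21*k+7 ∨ v = 15*k+7 ∨ v = 21*k+9 := by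
    omega
  rcases hc with h | h | h | h | h | h | h | h | h | h | h | h | h | h | h | h
  · exact ⟨12*k+2, by omega, by omega, by unfold Blk; omega, by rw [h0]; omega⟩
  · exact ⟨12*k+2, by omega, by omega, by unfold Blk; omega, by rw [h0]; omega⟩
  · exact ⟨12*k+0, by omega, by omega, by unfold Blk; omega, by rw [h1]; omega⟩
  · exact ⟨12*k+0, by omega, by omega, by unfold Blk; omega, by rw [h1]; omega⟩
  · exact ⟨12*k+1, by omega, by omega, by unfold Blk; omega, by rw [h2]; omega⟩
  · exact ⟨12*k+1, by omega, by omega, by unfold Blk; omega, by rw [h2]; omega⟩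
  · exact ⟨1, by omega, by omega, by unfold Blk; omega, by rw [h3]; omega⟩
  · exact ⟨1, by omega, by omega, by unfold Blk; omega, by rw [h3]; omega⟩
  · exact ⟨6*k+0, by omega, by omega, by unfold Blk; omega, by rw [h4]; omega⟩
  · exact ⟨6*k+0, by omega, by omega, by unfold Blk; omega, by rw [h4]; omega⟩
  · exact ⟨2, by omega, by omega, by unfold Blk; omega, by rw [h5]; omega⟩
  · exact ⟨2, by omega, by omega, by unfold Blk; omega, by rw [h5]; omega⟩
  · exact ⟨6*k+1, by omega, by omega, by unfold Blk; omega, by rw [h6]; omega⟩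
  · exact ⟨6*k+1, by omega, by omega, by unfold Blk; omega, by rw [h6]; omega⟩
  · exact ⟨6*k+2, by omega, by omega, by unfold Blk; omega, by rw [h7]; omega⟩
  · exact ⟨6*k+2, by omega, by omega, by unfold Blk; omega, by rw [h7]; omega⟩

def patch8 (k d : ℕ) : ℕ :=
  if d = 12*k+5 then 6*k+0 else if d = 12*k+3 then 24*k+15 else if d = 12*k+4 then 24*k+13 else if d = 1 then 18*k+6 else if d = 6*k+6 then 18*k+8 else if d = 2 then 21*k+9 else if d = 6*k+7 then 15*k+3 else if d = 6*k+8 then 15*k+4 else 0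

set_option maxHeartbeats 1000000 in
theorem inst8 (k : ℕ) (hk : 1 ≤ k) : Goal (12 * k + 8) := by
  refine core (12 * k + 8) (2*k) (2*k+1) (k) 2 (patch8 k) (by omega) (by omega) (by omega) (by omega) (by omega) (by omega) ?_
  intro v hv
  unfold PC at hv
  have h0 : patch8 k (12*k+5) = 6*k+0 := by
    unfold patch8; rw [if_pos rfl]
  have h1 : patch8 k (12*k+3) = 24*k+15 := by
    unfold patch8; rw [if_neg (by omega), if_pos rfl]
  have h2 : patch8 k (12*k+4) = 24*k+13 := by
    unfold patch8; rw [if_neg (by omega), if_neg (by omega), if_pos rfl]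
  have h3 : patch8 k (1) = 18*k+6 := by
    unfold patch8; rw [if_neg (by omega), if_neg (by omega), if_neg (by omega), if_pos rfl]
  have h4 : patch8 k (6*k+6) = 18*k+8 := by
    unfold patch8; rw [if_neg (by omega), if_neg (by omega), if_neg (by omega), if_neg (by omega), if_pos rfl]
  have h5 : patch8 k (2) = 21*k+9 := by
    unfold patch8; rw [if_neg (by omega), if_neg (by omega), if_neg (by omega), if_neg (by omega), if_neg (by omega), if_pos rfl]
  have h6 : patch8 k (6*k+7) = 15*k+3 := by
    unfold patch8; rw [if_neg (by omega), if_neg (by omega), if_neg (by omega), if_neg (by omega), if_neg (by omega), if_neg (by omega), if_pos rfl]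
  have h7 : patch8 k (6*k+8) = 15*k+4 := by
    unfold patch8; rw [if_neg (by omega), if_neg (by omega), if_neg (by omega), if_neg (by omega), if_neg (by omega), if_neg (by omega), if_neg (by omega), if_pos rfl]
  have hc : v = 6*k+0 ∨ v = 18*k+5 ∨ v = 24*k+15 ∨ v = 12*k+2 ∨ v = 24*k+13 ∨ v = 12*k+1 ∨ v = 18*k+6 ∨ v = 18*k+7 ∨ v = 18*k+8 ∨ v = 24*k+14 ∨ v = 21*k+9 ∨ v = 21*k+11 ∨ v = 15*k+3 ∨ v = 21*k+10 ∨ v = 15*k+4 ∨ v = 21*k+12 := by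
    omega
  rcases hc with h | h | h | h | h | h | h | h | h | h | h | h | h | h | h | h
  · exact ⟨12*k+5, by omega, by omega, by unfold Blk; omega, by rw [h0]; omega⟩
  · exact ⟨12*k+5, by omega, by omega, by unfold Blk; omega, by rw [h0]; omega⟩
  · exact ⟨12*k+3, by omega, by omega, by unfold Blk; omega, by rw [h1]; omega⟩
  · exact ⟨12*k+3, by omega, by omega, by unfold Blk; omega, by rw [h1]; omega⟩
  · exact ⟨12*k+4, by omega, by omega, by unfold Blk; omega, by rw [h2]; omega⟩
  · exact ⟨12*k+4, by omega, by omega, by unfold Blk; omega, by rw [h2]; omega⟩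
  · exact ⟨1, by omega, by omega, by unfold Blk; omega, by rw [h3]; omega⟩
  · exact ⟨1, by omega, by omega, by unfold Blk; omega, by rw [h3]; omega⟩
  · exact ⟨6*k+6, by omega, by omega, by unfold Blk; omega, by rw [h4]; omega⟩
  · exact ⟨6*k+6, by omega, by omega, by unfold Blk; omega, by rw [h4]; omega⟩
  · exact ⟨2, by omega, by omega, by unfold Blk; omega, by rw [h5]; omega⟩
  · exact ⟨2, by omega, by omega, by unfold Blk; omega, by rw [h5]; omega⟩
  · exact ⟨6*k+7, by omega, by omega, by unfold Blk; omega, by rw [h6]; omega⟩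
  · exact ⟨6*k+7, by omega, by omega, by unfold Blk; omega, by rw [h6]; omega⟩
  · exact ⟨6*k+8, by omega, by omega, by unfold Blk; omega, by rw [h7]; omega⟩
  · exact ⟨6*k+8, by omega, by omega, by unfold Blk; omega, by rw [h7]; omega⟩

def patch9 (k d : ℕ) : ℕ :=
  if d = 12*k+9 then 6*k+3 else if d = 1 then 18*k+9 else if d = 6*k+6 then 18*k+11 else if d = 2 then 21*k+13 else if d = 6*k+7 then 15*k+7 else if d = 6*k+8 then 15*k+8 else 0

set_option maxHeartbeats 1000000 in
theorem inst9 (k : ℕ) (hk : 0 ≤ k) : Goal (12 * k + 9) := by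
  refine core (12 * k + 9) (2*k+1) (2*k+1) (k) 0 (patch9 k) (by omega) (by omega) (by omega) (by omega) (by omega) (by omega) ?_
  intro v hv
  unfold PC at hv
  have h0 : patch9 k (12*k+9) = 6*k+3 := by
    unfold patch9; rw [if_pos rfl]
  have h1 : patch9 k (1) = 18*k+9 := by
    unfold patch9; rw [if_neg (by omega), if_pos rfl]
  have h2 : patch9 k (6*k+6) = 18*k+11 := by
    unfold patch9; rw [if_neg (by omega), if_neg (by omega), if_pos rfl]
  have h3 : patch9 k (2) = 21*k+13 := by
    unfold patch9; rw [if_neg (by omega), if_neg (by omega), if_neg (by omega), if_pos rfl]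
  have h4 : patch9 k (6*k+7) = 15*k+7 := by
    unfold patch9; rw [if_neg (by omega), if_neg (by omega), if_neg (by omega), if_neg (by omega), if_pos rfl]
  have h5 : patch9 k (6*k+8) = 15*k+8 := by
    unfold patch9; rw [if_neg (by omega), if_neg (by omega), if_neg (by omega), if_neg (by omega), if_neg (by omega), if_pos rfl]
  have hc : v = 6*k+3 ∨ v = 18*k+12 ∨ v = 18*k+9 ∨ v = 18*k+10 ∨ v = 18*k+11 ∨ v = 24*k+17 ∨ v = 21*k+13 ∨ v = 21*k+15 ∨ v = 15*k+7 ∨ v = 21*k+14 ∨ v = 15*k+8 ∨ v = 21*k+16 := by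
    omega
  rcases hc with h | h | h | h | h | h | h | h | h | h | h | h
  · exact ⟨12*k+9, by omega, by omega, by unfold Blk; omega, by rw [h0]; omega⟩
  · exact ⟨12*k+9, by omega, by omega, by unfold Blk; omega, by rw [h0]; omega⟩
  · exact ⟨1, by omega, by omega, by unfold Blk; omega, by rw [h1]; omega⟩
  · exact ⟨1, by omega, by omega, by unfold Blk; omega, by rw [h1]; omega⟩
  · exact ⟨6*k+6, by omega, by omega, by unfold Blk; omega, by rw [h2]; omega⟩
  · exact ⟨6*k+6, by omega, by omega, by unfold Blk; omega, by rw [h2]; omega⟩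
  · exact ⟨2, by omega, by omega, by unfold Blk; omega, by rw [h3]; omega⟩
  · exact ⟨2, by omega, by omega, by unfold Blk; omega, by rw [h3]; omega⟩
  · exact ⟨6*k+7, by omega, by omega, by unfold Blk; omega, by rw [h4]; omega⟩
  · exact ⟨6*k+7, by omega, by omega, by unfold Blk; omega, by rw [h4]; omega⟩
  · exact ⟨6*k+8, by omega, by omega, by unfold Blk; omega, by rw [h5]; omega⟩
  · exact ⟨6*k+8, by omega, by omega, by unfold Blk; omega, by rw [h5]; omega⟩

/-- For `m ≥ 8`, `m ≡ 0,1 (mod 4)`, there are at least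
`2^(⌊m/3⌋-1)/(2 + log₂ m) + 1` circle-equivalence classes of Skolem circles of
order `m`: there is a set of pairwise non-equivalent Skolem circles of at least
that size. -/
theorem skolemCircle_classes_lower_bound (m : ℕ) (hm : 8 ≤ m)
    (h4 : m % 4 = 0 ∨ m % 4 = 1) :
    ∃ S : Set ((Fin m → ZMod (2 * m)) × (Fin m → ZMod (2 * m))),
      (∀ p ∈ S, IsSkolemCircle m p.1 p.2) ∧
      (∀ p ∈ S, ∀ q ∈ S, CircleEquiv m p q → p = q) ∧
      (2 : ℝ) ^ (m / 3 - 1) / (2 + Real.logb 2 m) + 1 ≤ S.ncard := by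
  change Goal m
  by_cases h8 : m = 8
  · rw [h8]; exact inst_eight
  obtain ⟨k, hk⟩ : ∃ k, k = m / 12 := ⟨_, rfl⟩
  have h : m = 12 * k + 0 ∨ m = 12 * k + 1 ∨ m = 12 * k + 4 ∨ m = 12 * k + 5 ∨ m = 12 * k + 8 ∨
      m = 12 * k + 9 := by omega
  rcases h with h | h | h | h | h | h
  · rw [h]; exact inst0 k (by omega)
  · rw [h]; exact inst1 k (by omega)
  · rw [h]; exact inst4 k (by omega)
  · rw [h]; exact inst5 k (by omega)
  · rw [h]; exact inst8 k (by omega)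
  · rw [h]; exact inst9 k (by omega)
end
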